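/- arXiv:math/0509672 — 6 statements merged into one kernel-verified Lean document; each statement's English description precedes it below -/
import Mathlib

section
/- Pascal's theorem in invariant-theoretic form (Theorem 2): For any six points P_1,…,P_6 ∈ ℝ², let f_1 := J(ℓ_{P_1}ℓ_{P_2}, ℓ_{P_4}ℓ_{P_5}), f_2 := J(ℓ_{P_2}ℓ_{P_3}, ℓ_{P_5}ℓ_{P_6}), and f_3 := J(ℓ_{P_3}ℓ_{P_4}, ℓ_{P_1}ℓ_{P_6}) be the Jacobians of the indicated products of linear forms. Then the combinant vanishes: C(f_1, f_2, f_3) = 0. -/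
noncomputable section

/-- Coefficient triple `(a, b, c)` (for `a x² + 2b xy + c y²`) of the product
    `ℓ_P ℓ_Q` of the two linear forms `ℓ_P = x P_y − y P_x`, `ℓ_Q = x Q_y − y Q_x`. -/
def prodForm (P Q : ℝ × ℝ) : ℝ × ℝ × ℝ :=
  (P.2 * Q.2, -(P.1 * Q.2 + P.2 * Q.1) / 2, P.1 * Q.1)

/-- Coefficient triple of the Jacobian `∂ₓf·∂_yf' − ∂_yf·∂ₓf'` of two binary
    quadratic forms given by their coefficient triples. -/
def jac (f g : ℝ × ℝ × ℝ) : ℝ × ℝ × ℝ :=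
  (4 * (f.1 * g.2.1 - g.1 * f.2.1), 2 * (f.1 * g.2.2 - g.1 * f.2.2),
   4 * (f.2.1 * g.2.2 - g.2.1 * f.2.2))

/-- The combinant of three binary quadratic forms: the determinant of the 3×3 matrix
    of their coefficient triples. -/
def comb (f g h : ℝ × ℝ × ℝ) : ℝ :=
  Matrix.det !![f.1, f.2.1, f.2.2; g.1, g.2.1, g.2.2; h.1, h.2.1, h.2.2]

/-- Pascal's theorem in invariant-theoretic form: for any six points `P₁,…,P₆ ∈ ℝ²`,
    the combinant of the three Jacobians `J(ℓ₁ℓ₂, ℓ₄ℓ₅)`, `J(ℓ₂ℓ₃, ℓ₅ℓ₆)`,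
    `J(ℓ₃ℓ₄, ℓ₁ℓ₆)` vanishes. -/
theorem pascal_invariant_form (P₁ P₂ P₃ P₄ P₅ P₆ : ℝ × ℝ) :
    comb (jac (prodForm P₁ P₂) (prodForm P₄ P₅))
         (jac (prodForm P₂ P₃) (prodForm P₅ P₆))
         (jac (prodForm P₃ P₄) (prodForm P₁ P₆)) = 0 := by
  obtain ⟨a, b⟩ := P₁
  obtain ⟨c, d⟩ := P₂
  obtain ⟨e, f⟩ := P₃
  obtain ⟨g, h⟩ := P₄
  obtain ⟨i, j⟩ := P₅
  obtain ⟨k, l⟩ := P₆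
  simp [comb, jac, prodForm, Matrix.det_fin_three]
  ring
end
end

section
/- Proposition 1 (harmonic-pair form of Pascal's theorem): Let P_a, P_b, P_c, P_d, P_e, P_f ∈ ℝ² be nonzero and pairwise non-proportional (six distinct points of the real projective line), and let A_1,B_1,A_2,B_2,A_3,B_3 ∈ ℝ² be nonzero. Set g_i := ℓ_{A_i}ℓ_{B_i}. Assume the pair {A_1,B_1} is in harmonic position to both {P_a,P_b} and {P_d,P_e} (i.e. ⟨g_1, ℓ_{P_a}ℓ_{P_b}⟩ = 0 and ⟨g_1, ℓ_{P_d}ℓ_{P_e}⟩ = 0), the pair {A_2,B_2} is in harmonic position to both {P_b,P_c} and {P_e,P_f} (i.e. ⟨g_2, ℓ_{P_b}ℓ_{P_c}⟩ = 0 and ⟨g_2, ℓ_{P_e}ℓ_{P_f}⟩ = 0), and the pair {A_3,B_3} is in harmonic position to both {P_c,P_d} and {P_f,P_a} (i.e. ⟨g_3, ℓ_{P_c}ℓ_{P_d}⟩ = 0 and ⟨g_3, ℓ_{P_f}ℓ_{P_a}⟩ = 0). Then the three point pairs are in involution, i.e. the combinant vanishes: C(g_1, g_2, g_3) = 0. 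-/
noncomputable section

/-- The apolar pairing `⟨f, f'⟩ = a c' + c a' − 2 b b'` of two binary quadratic
    forms given by their coefficient triples. -/
def apolar (f g : ℝ × ℝ × ℝ) : ℝ :=
  f.1 * g.2.2 + f.2.2 * g.1 - 2 * f.2.1 * g.2.1

/-- A multiple of the Jacobian of two binary quadratic forms, spanning the forms
    apolar to both whenever it is nonzero. -/
def jacobianForm (u v : ℝ × ℝ × ℝ) : ℝ × ℝ × ℝ :=
  (2 * (u.1 * v.2.1 - u.2.1 * v.1), u.1 * v.2.2 - u.2.2 * v.1,
    2 * (u.2.1 * v.2.2 - u.2.2 * v.2.1))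

theorem cross_ne_zero_of_not_proportional {P Q : ℝ × ℝ} (hP : P ≠ 0)
    (h : ¬ ∃ c : ℝ, Q = c • P) : P.1 * Q.2 - P.2 * Q.1 ≠ 0 := by
  obtain ⟨p, q⟩ := P
  obtain ⟨r, s⟩ := Q
  intro h0
  simp only at h0
  by_cases hp : p = 0
  · have hq : q ≠ 0 := fun hq => hP (by simp [hp, hq])
    refine h ⟨s / q, ?_⟩
    ext
    · simp only [Prod.smul_mk, smul_eq_mul]
      field_simp
      linarith
    · simp only [Prod.smul_mk, smul_eq_mul]
      field_simp
  · refine h ⟨r / p, ?_⟩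
    ext
    · simp only [Prod.smul_mk, smul_eq_mul]
      field_simp
    · simp only [Prod.smul_mk, smul_eq_mul]
      field_simp
      linarith

theorem jacobianForm_prodForm_ne_zero {P Q R S : ℝ × ℝ}
    (hPR : P.1 * R.2 - P.2 * R.1 ≠ 0) (hPS : P.1 * S.2 - P.2 * S.1 ≠ 0)
    (hQR : Q.1 * R.2 - Q.2 * R.1 ≠ 0) (hQS : Q.1 * S.2 - Q.2 * S.1 ≠ 0) :
    jacobianForm (prodForm P Q) (prodForm R S) ≠ 0 := by
  intro h
  have h1 := congrArg Prod.fst h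
  have h2 := congrArg (fun x => x.2.1) h
  have resultant_eq : (P.1 * R.2 - P.2 * R.1) * (P.1 * S.2 - P.2 * S.1) *
      (Q.1 * R.2 - Q.2 * R.1) * (Q.1 * S.2 - Q.2 * S.1) =
      (jacobianForm (prodForm P Q) (prodForm R S)).2.1 ^ 2 -
        (jacobianForm (prodForm P Q) (prodForm R S)).1 *
          (jacobianForm (prodForm P Q) (prodForm R S)).2.2 := by
    simp only [jacobianForm, prodForm]
    ring
  rw [h] at resultant_eq
  simp [hPR, hPS, hQR, hQS] at resultant_eq

theorem exists_eq_smul_jacobianForm {g u v : ℝ × ℝ × ℝ} (hw : jacobianForm u v ≠ 0)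
    (hu : apolar g u = 0) (hv : apolar g v = 0) : ∃ t : ℝ, g = t • jacobianForm u v := by
  obtain ⟨g₁, g₂, g₃⟩ := g
  have h12 : g₁ * (jacobianForm u v).2.1 = g₂ * (jacobianForm u v).1 := by
    simp only [apolar, jacobianForm] at *
    linear_combination u.1 * hv - v.1 * hu
  have h13 : g₁ * (jacobianForm u v).2.2 = g₃ * (jacobianForm u v).1 := by
    simp only [apolar, jacobianForm] at *
    linear_combination 2 * u.2.1 * hv - 2 * v.2.1 * hu
  have h23 : g₂ * (jacobianForm u v).2.2 = g₃ * (jacobianForm u v).2.1 := by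
    simp only [apolar, jacobianForm] at *
    linear_combination u.2.2 * hv - v.2.2 * hu
  generalize jacobianForm u v = w at *
  obtain ⟨w₁, w₂, w₃⟩ := w
  simp only at h12 h13 h23
  simp only [Prod.smul_mk, smul_eq_mul, Prod.mk.injEq]
  by_cases h1 : w₁ = 0
  · by_cases h2 : w₂ = 0
    · have h3 : w₃ ≠ 0 := fun h3 => hw (by simp [h1, h2, h3])
      exact ⟨g₃ / w₃, by field_simp; linarith, by field_simp; linarith, by field_simp⟩
    · exact ⟨g₂ / w₂, by field_simp; linarith, by field_simp, by field_simp; linarith⟩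
  · exact ⟨g₁ / w₁, by field_simp, by field_simp; linarith, by field_simp; linarith⟩

theorem comb_smul (r s t : ℝ) (f g h : ℝ × ℝ × ℝ) :
    comb (r • f) (s • g) (t • h) = r * s * t * comb f g h := by
  simp only [comb, Matrix.det_fin_three, Matrix.of_apply, Matrix.cons_val, Prod.smul_fst,
    Prod.smul_snd, smul_eq_mul]
  ring

/-- Pascal's theorem for a hexagon inscribed in the conic of squares. -/
theorem comb_jacobianForm_hexagon (Pa Pb Pc Pd Pe Pf : ℝ × ℝ) :
    comb (jacobianForm (prodForm Pa Pb) (prodForm Pd Pe))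
      (jacobianForm (prodForm Pb Pc) (prodForm Pe Pf))
      (jacobianForm (prodForm Pc Pd) (prodForm Pf Pa)) = 0 := by
  simp only [comb, Matrix.det_fin_three, Matrix.of_apply, Matrix.cons_val, jacobianForm, prodForm]
  ring

/-- Proposition 1 (harmonic-pair form of Pascal's theorem): if the pair `{Aᵢ, Bᵢ}`
    is in harmonic position (apolar) to the indicated pairs of the six distinct
    points `P_a, …, P_f` of the real projective line, then the three point pairs
    `{Aᵢ, Bᵢ}` are in involution, i.e. their combinant vanishes. -/
theorem proposition_one
    (Pa Pb Pc Pd Pe Pf : ℝ × ℝ)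
    (hPa : Pa ≠ 0) (hPb : Pb ≠ 0) (hPc : Pc ≠ 0)
    (hPd : Pd ≠ 0) (hPe : Pe ≠ 0) (hPf : Pf ≠ 0)
    (hdist : List.Pairwise (fun P Q : ℝ × ℝ => ¬ ∃ c : ℝ, Q = c • P)
      [Pa, Pb, Pc, Pd, Pe, Pf])
    (A₁ B₁ A₂ B₂ A₃ B₃ : ℝ × ℝ)
    (hA₁ : A₁ ≠ 0) (hB₁ : B₁ ≠ 0) (hA₂ : A₂ ≠ 0) (hB₂ : B₂ ≠ 0)
    (hA₃ : A₃ ≠ 0) (hB₃ : B₃ ≠ 0)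
    (h1ab : apolar (prodForm A₁ B₁) (prodForm Pa Pb) = 0)
    (h1de : apolar (prodForm A₁ B₁) (prodForm Pd Pe) = 0)
    (h2bc : apolar (prodForm A₂ B₂) (prodForm Pb Pc) = 0)
    (h2ef : apolar (prodForm A₂ B₂) (prodForm Pe Pf) = 0)
    (h3cd : apolar (prodForm A₃ B₃) (prodForm Pc Pd) = 0)
    (h3fa : apolar (prodForm A₃ B₃) (prodForm Pf Pa) = 0) :
    comb (prodForm A₁ B₁) (prodForm A₂ B₂) (prodForm A₃ B₃) = 0 := by
  simp only [List.pairwise_cons, List.mem_cons, forall_eq_or_imp] at hdist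
  obtain ⟨⟨-, hac, had, hae, -⟩, ⟨-, hbd, hbe, hbf, -⟩, ⟨-, hce, hcf, -⟩,
    ⟨-, hdf, -⟩, -⟩ := hdist
  replace hac := cross_ne_zero_of_not_proportional hPa hac
  replace had := cross_ne_zero_of_not_proportional hPa had
  replace hae := cross_ne_zero_of_not_proportional hPa hae
  replace hbd := cross_ne_zero_of_not_proportional hPb hbd
  replace hbe := cross_ne_zero_of_not_proportional hPb hbe
  replace hbf := cross_ne_zero_of_not_proportional hPb hbf
  replace hce := cross_ne_zero_of_not_proportional hPc hce
  replace hcf := cross_ne_zero_of_not_proportional hPc hcf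
  replace hdf := cross_ne_zero_of_not_proportional hPd hdf
  have hca : Pc.1 * Pa.2 - Pc.2 * Pa.1 ≠ 0 := fun h => hac (by linarith)
  have hda : Pd.1 * Pa.2 - Pd.2 * Pa.1 ≠ 0 := fun h => had (by linarith)
  obtain ⟨r, hr⟩ := exists_eq_smul_jacobianForm
    (jacobianForm_prodForm_ne_zero had hae hbd hbe) h1ab h1de
  obtain ⟨s, hs⟩ := exists_eq_smul_jacobianForm
    (jacobianForm_prodForm_ne_zero hbe hbf hce hcf) h2bc h2ef
  obtain ⟨t, ht⟩ := exists_eq_smul_jacobianForm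
    (jacobianForm_prodForm_ne_zero hcf hca hdf hda) h3cd h3fa
  rw [hr, hs, ht, comb_smul, comb_jacobianForm_hexagon, mul_zero]

end
end

section
/- If three point pairs admit a common involution then their combinant vanishes: Let M be a 2×2 real matrix with M² = k·I for some k ≠ 0 and M not a scalar multiple of the identity (so M induces an involutive projective map of the real projective line). Let A_1,B_1,A_2,B_2,A_3,B_3 ∈ ℝ² be nonzero vectors such that for each i = 1,2,3 the vector M·A_i is proportional to B_i and M·B_i is proportional to A_i (the involution interchanges the points of each pair). Then, with g_i := ℓ_{A_i}ℓ_{B_i}, the combinant vanishes: C(g_1, g_2, g_3) = 0. -/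
noncomputable section

/-- A non-scalar `2 × 2` real matrix whose square is scalar has trace zero. -/
theorem add_diag_eq_zero_of_mul_self_eq_smul_one {M : Matrix (Fin 2) (Fin 2) ℝ} {k : ℝ}
    (hM : M * M = k • (1 : Matrix (Fin 2) (Fin 2) ℝ))
    (hs : ¬ ∃ c : ℝ, M = c • (1 : Matrix (Fin 2) (Fin 2) ℝ)) :
    M 0 0 + M 1 1 = 0 := by
  by_contra ht
  have h00 := congrFun (congrFun hM 0) 0
  have h01 := congrFun (congrFun hM 0) 1
  have h10 := congrFun (congrFun hM 1) 0
  have h11 := congrFun (congrFun hM 1) 1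
  simp [Matrix.mul_apply, Fin.sum_univ_two] at h00 h01 h10 h11
  have hq : M 0 1 = 0 := mul_left_cancel₀ ht (by linear_combination h01)
  have hr : M 1 0 = 0 := mul_left_cancel₀ ht (by linear_combination h10)
  have hd : M 0 0 = M 1 1 := mul_left_cancel₀ ht (by linear_combination h00 - h11)
  refine hs ⟨M 0 0, ?_⟩
  ext i j
  fin_cases i <;> fin_cases j <;> simp [hq, hr, hd]

/-- If a traceless matrix `M` sends `P` to a multiple of `Q`, then the coefficient triple of
`ℓ_P ℓ_Q` satisfies a linear relation depending only on `M`. -/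
theorem prodForm_linear_relation {M : Matrix (Fin 2) (Fin 2) ℝ} (ht : M 0 0 + M 1 1 = 0)
    {P Q : ℝ × ℝ} (h : ∃ c : ℝ, M.mulVec ![P.1, P.2] = c • ![Q.1, Q.2]) :
    (prodForm P Q).1 * M 0 1 + (prodForm P Q).2.1 * (-2 * M 0 0)
      + (prodForm P Q).2.2 * (-M 1 0) = 0 := by
  obtain ⟨c, hc⟩ := h
  have h0 := congrFun hc 0
  have h1 := congrFun hc 1
  simp [Matrix.mulVec, dotProduct, Fin.sum_univ_two] at h0 h1
  simp only [prodForm]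
  linear_combination Q.2 * h0 - Q.1 * h1 + P.2 * Q.1 * ht

/-- If three point pairs `{Aᵢ, Bᵢ}` admit a common involution (induced by a 2×2 matrix
    `M` with `M² = k·I`, `k ≠ 0`, `M` not scalar, interchanging the points of each pair),
    then the combinant of the three corresponding quadratic forms vanishes. -/
theorem common_involution_combinant_vanishes
    (M : Matrix (Fin 2) (Fin 2) ℝ) (k : ℝ) (hk : k ≠ 0)
    (hM : M * M = k • (1 : Matrix (Fin 2) (Fin 2) ℝ))
    (hMnotscalar : ¬ ∃ c : ℝ, M = c • (1 : Matrix (Fin 2) (Fin 2) ℝ))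
    (A B : Fin 3 → ℝ × ℝ)
    (hA : ∀ i, A i ≠ 0) (hB : ∀ i, B i ≠ 0)
    (hAB : ∀ i, ∃ c : ℝ, M.mulVec ![(A i).1, (A i).2] = c • ![(B i).1, (B i).2])
    (hBA : ∀ i, ∃ c : ℝ, M.mulVec ![(B i).1, (B i).2] = c • ![(A i).1, (A i).2]) :
    comb (prodForm (A 0) (B 0)) (prodForm (A 1) (B 1)) (prodForm (A 2) (B 2)) = 0 := by
  have ht := add_diag_eq_zero_of_mul_self_eq_smul_one hM hMnotscalar
  refine Matrix.exists_mulVec_eq_zero_iff.mp ⟨![M 0 1, -2 * M 0 0, -M 1 0], ?_, ?_⟩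
  · intro hv
    have hq := congrFun hv 0
    have hp := congrFun hv 1
    have hr := congrFun hv 2
    simp at hq hp hr
    have hs : M 1 1 = 0 := by linear_combination ht - hp
    refine hMnotscalar ⟨0, ?_⟩
    ext i j
    fin_cases i <;> fin_cases j <;> simp [hq, hp, hr, hs]
  · have key := fun i => prodForm_linear_relation ht (hAB i)
    ext i
    fin_cases i
    · simpa [Matrix.mulVec, dotProduct, Fin.sum_univ_three] using key 0
    · simpa [Matrix.mulVec, dotProduct, Fin.sum_univ_three] using key 1
    · simpa [Matrix.mulVec, dotProduct, Fin.sum_univ_three] using key 2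

end
end

section
/- Uniqueness of the harmonic pair: Let f and f' be linearly independent binary quadratic forms over ℝ. Then J(f,f') ≠ 0, and the set of binary quadratic forms g with ⟨g,f⟩ = 0 and ⟨g,f'⟩ = 0 is exactly the one-dimensional subspace ℝ · J(f,f'). In other words, the (unique up to scalar) quadratic form whose zeros are in harmonic position to the zeros of f and to the zeros of f' is the Jacobian J(f,f'). -/
noncomputable section

theorem jac_ne_zero {f f' : ℝ × ℝ × ℝ} (h : LinearIndependent ℝ ![f, f']) :
    jac f f' ≠ 0 := by
  obtain ⟨a, b, c⟩ := f
  obtain ⟨a', b', c'⟩ := f'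
  rw [LinearIndependent.pair_iff] at h
  intro h0
  simp only [jac, Prod.mk_eq_zero] at h0
  obtain ⟨h1, h2, h3⟩ := h0
  simp only [Prod.smul_mk, Prod.mk_add_mk, Prod.mk_eq_zero, smul_eq_mul] at h
  have ha := (h a' (-a) ⟨by linarith, by linarith, by linarith⟩).2
  have hb := (h b' (-b) ⟨by linarith, by linarith, by linarith⟩).2
  have hc := (h c' (-c) ⟨by linarith, by linarith, by linarith⟩).2
  have := (h 1 0 ⟨by linarith, by linarith, by linarith⟩).1
  exact one_ne_zero this

theorem apolar_smul_jac_left (t : ℝ) (f f' : ℝ × ℝ × ℝ) :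
    apolar (t • jac f f') f = 0 := by
  simp only [apolar, jac, Prod.smul_mk, smul_eq_mul]
  ring

theorem apolar_smul_jac_right (t : ℝ) (f f' : ℝ × ℝ × ℝ) :
    apolar (t • jac f f') f' = 0 := by
  simp only [apolar, jac, Prod.smul_mk, smul_eq_mul]
  ring

/-- A form apolar to both `f` and `f'` is a multiple of their Jacobian, if that is nonzero. -/
theorem exists_smul_jac_eq {f f' g : ℝ × ℝ × ℝ} (hJ : jac f f' ≠ 0)
    (h : apolar g f = 0) (h' : apolar g f' = 0) : ∃ t : ℝ, t • jac f f' = g := by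
  obtain ⟨a, b, c⟩ := f
  obtain ⟨a', b', c'⟩ := f'
  obtain ⟨u, v, w⟩ := g
  simp only [apolar] at h h'
  simp only [jac, ne_eq, Prod.mk_eq_zero, Prod.smul_mk, smul_eq_mul, Prod.mk.injEq] at hJ ⊢
  have huv : u * (a * c' - a' * c) = 2 * v * (a * b' - a' * b) := by
    linear_combination a * h' - a' * h
  have huw : u * (b * c' - b' * c) = w * (a * b' - a' * b) := by
    linear_combination b * h' - b' * h
  have hvw : 2 * v * (b * c' - b' * c) = w * (a * c' - a' * c) := by
    linear_combination c * h' - c' * h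
  generalize a * b' - a' * b = p at *
  generalize a * c' - a' * c = q at *
  generalize b * c' - b' * c = r at *
  by_cases hp : p = 0
  · by_cases hq : q = 0
    · have hr : r ≠ 0 := fun hr => hJ (by simp [hp, hq, hr])
      refine ⟨w / (4 * r), ?_, ?_, ?_⟩ <;> field_simp <;> linarith
    · refine ⟨v / (2 * q), ?_, ?_, ?_⟩ <;> field_simp <;> linarith
  · refine ⟨u / (4 * p), ?_, ?_, ?_⟩ <;> field_simp <;> linarith

/-- Uniqueness of the harmonic pair: if `f, f'` are linearly independent binary
    quadratic forms then `J(f,f') ≠ 0` and the forms apolar to both `f` and `f'`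
    are exactly the scalar multiples of the Jacobian `J(f,f')`. -/
theorem harmonic_pair_unique (f f' : ℝ × ℝ × ℝ)
    (h : LinearIndependent ℝ ![f, f']) :
    jac f f' ≠ 0 ∧
      {g : ℝ × ℝ × ℝ | apolar g f = 0 ∧ apolar g f' = 0} =
        ↑(Submodule.span ℝ {jac f f'}) := by
  have hJ := jac_ne_zero h
  refine ⟨hJ, Set.ext fun g => ?_⟩
  rw [SetLike.mem_coe, Submodule.mem_span_singleton]
  constructor
  · rintro ⟨h1, h2⟩
    exact exists_smul_jac_eq hJ h1 h2
  · rintro ⟨t, rfl⟩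
    exact ⟨apolar_smul_jac_left t f f', apolar_smul_jac_right t f f'⟩

end
end

section
/- Commutation relations among quantum brackets: In the setting of the quantum coordinate relations, for all indices i < j < k one has (jk)(ij) = q⁴ (ij)(jk), (ik)(ij) = q² (ij)(ik), and (jk)(ik) = q² (ik)(jk). -/
noncomputable section

/-- The quantum bracket `(ij) := p⁻¹ xᵢ yⱼ − p yᵢ xⱼ` (where `p² = q`). -/
def qBracket {A : Type*} [Ring A] [Algebra ℂ A] {n : ℕ} (p : ℂ)
    (x y : Fin n → A) (i j : Fin n) : A :=
  p⁻¹ • (x i * y j) - p • (y i * x j)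

/-- Commutation relations among quantum brackets: for `i < j < k`,
    `(jk)(ij) = q⁴ (ij)(jk)`, `(ik)(ij) = q² (ij)(ik)`, `(jk)(ik) = q² (ik)(jk)`. -/
theorem qBracket_commutation {A : Type*} [Ring A] [Algebra ℂ A]
    (q p : ℂ) (hq : q ≠ 0) (hp : p ^ 2 = q) (N : ℕ) (x y : Fin (N + 1) → A)
    (hxy : ∀ i, x i * y i = q • (y i * x i))
    (hxx : ∀ i j, i < j → x j * x i = (q ^ 2) • (x i * x j))
    (hyy : ∀ i j, i < j → y j * y i = (q ^ 2) • (y i * y j))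
    (hxy' : ∀ i j, i < j → x j * y i = q • (y i * x j) + (q ^ 2 - 1) • (x i * y j))
    (hyx : ∀ i j, i < j → y j * x i = q • (x i * y j))
    (i j k : Fin (N + 1)) (hij : i < j) (hjk : j < k) :
    qBracket p x y j k * qBracket p x y i j =
        (q ^ 4) • (qBracket p x y i j * qBracket p x y j k) ∧
    qBracket p x y i k * qBracket p x y i j =
        (q ^ 2) • (qBracket p x y i j * qBracket p x y i k) ∧
    qBracket p x y j k * qBracket p x y i k =
        (q ^ 2) • (qBracket p x y i k * qBracket p x y j k) := by
  have hp0 : p ≠ 0 := by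
    rintro rfl
    exact hq (by simpa using hp.symm)
  subst hp
  have hik := hij.trans hjk
  -- the relations with a trailing factor, for words in right-associated form
  have hxy_assoc (i) (z : A) : x i * (y i * z) = p ^ 2 • (y i * (x i * z)) := by
    rw [← mul_assoc, hxy, smul_mul_assoc, mul_assoc]
  have hxx_assoc (i j) (h : i < j) (z : A) :
      x j * (x i * z) = (p ^ 2) ^ 2 • (x i * (x j * z)) := by
    rw [← mul_assoc, hxx i j h, smul_mul_assoc, mul_assoc]
  have hyy_assoc (i j) (h : i < j) (z : A) :
      y j * (y i * z) = (p ^ 2) ^ 2 • (y i * (y j * z)) := by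
    rw [← mul_assoc, hyy i j h, smul_mul_assoc, mul_assoc]
  have hxy'_assoc (i j) (h : i < j) (z : A) :
      x j * (y i * z) =
        p ^ 2 • (y i * (x j * z)) + ((p ^ 2) ^ 2 - 1) • (x i * (y j * z)) := by
    rw [← mul_assoc, hxy' i j h, add_mul, smul_mul_assoc, smul_mul_assoc, mul_assoc, mul_assoc]
  have hyx_assoc (i j) (h : i < j) (z : A) :
      y j * (x i * z) = p ^ 2 • (x i * (y j * z)) := by
    rw [← mul_assoc, hyx i j h, smul_mul_assoc, mul_assoc]
  refine ⟨?_, ?_, ?_⟩ <;>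
  · simp only [qBracket, sub_mul, mul_sub, mul_add, smul_mul_assoc, mul_smul_comm, mul_assoc,
      hxy, hxx, hyy, hxy', hyx, hxy_assoc, hxx_assoc, hyy_assoc, hxy'_assoc, hyx_assoc,
      hij, hik, hjk]
    match_scalars <;> field_simp <;> ring

end
end

section
/- Two expressions for the quantum quadratic form f_{ij}: In the setting of the quantum coordinate relations, for all indices 0 < i < j one has q (0i)(0j) = q^{−1} (0j)(0i). -/
noncomputable section

/-- The product `(kl)(km)`, for `k < l`, with the generators of index `k` moved to the left. -/
theorem qBracket_mul_qBracket {A : Type*} [Ring A] [Algebra ℂ A] {n : ℕ}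
    {q p : ℂ} (hq : q ≠ 0) (hp : p ^ 2 = q) {x y : Fin n → A} {k l : Fin n}
    (hxy : x k * y k = q • (y k * x k))
    (hxx : x l * x k = (q ^ 2) • (x k * x l))
    (hyy : y l * y k = (q ^ 2) • (y k * y l))
    (hxy' : x l * y k = q • (y k * x l) + (q ^ 2 - 1) • (x k * y l))
    (hyx : y l * x k = q • (x k * y l)) (m : Fin n) :
    qBracket p x y k l * qBracket p x y k m =
      x k * x k * (y l * y m) - q • (y k * x k * (y l * x m))
        - (q ^ 2) • (y k * x k * (x l * y m)) + (q ^ 2) • (y k * y k * (x l * x m)) := by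
  have hp0 : p ≠ 0 := by
    rintro rfl
    exact hq (by simpa using hp.symm)
  have h₁ : x k * y l * (x k * y m) = q • (x k * x k * (y l * y m)) := by
    rw [mul_assoc, ← mul_assoc (y l), hyx]
    simp only [smul_mul_assoc, mul_smul_comm, mul_assoc]
  have h₂ : x k * y l * (y k * x m) = (q ^ 3) • (y k * x k * (y l * x m)) := by
    rw [mul_assoc, ← mul_assoc (y l), hyy, smul_mul_assoc, mul_smul_comm, mul_assoc (y k),
      ← mul_assoc (x k), hxy, smul_mul_assoc, smul_smul]
    congr 1
  have h₃ : y k * x l * (x k * y m) = (q ^ 2) • (y k * x k * (x l * y m)) := by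
    rw [mul_assoc, ← mul_assoc (x l), hxx]
    simp only [smul_mul_assoc, mul_smul_comm, mul_assoc]
  have h₄ : y k * x l * (y k * x m) =
      q • (y k * y k * (x l * x m)) + (q ^ 2 - 1) • (y k * x k * (y l * x m)) := by
    rw [mul_assoc, ← mul_assoc (x l), hxy']
    simp only [add_mul, mul_add, smul_mul_assoc, mul_smul_comm, mul_assoc]
  simp only [qBracket, sub_mul, mul_sub, smul_mul_assoc, mul_smul_comm, h₁, h₂, h₃, h₄]
  subst hp
  match_scalars <;> field_simp <;> ring

/-- Two expressions for the quantum quadratic form `f_{ij}`: for `0 < i < j`,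
    `q (0i)(0j) = q⁻¹ (0j)(0i)`. -/
theorem qForm_two_expressions {A : Type*} [Ring A] [Algebra ℂ A]
    (q p : ℂ) (hq : q ≠ 0) (hp : p ^ 2 = q) (N : ℕ) (x y : Fin (N + 1) → A)
    (hxy : ∀ i, x i * y i = q • (y i * x i))
    (hxx : ∀ i j, i < j → x j * x i = (q ^ 2) • (x i * x j))
    (hyy : ∀ i j, i < j → y j * y i = (q ^ 2) • (y i * y j))
    (hxy' : ∀ i j, i < j → x j * y i = q • (y i * x j) + (q ^ 2 - 1) • (x i * y j))
    (hyx : ∀ i j, i < j → y j * x i = q • (x i * y j))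
    (i j : Fin (N + 1)) (h0i : 0 < i) (hij : i < j) :
    q • (qBracket p x y 0 i * qBracket p x y 0 j) =
      q⁻¹ • (qBracket p x y 0 j * qBracket p x y 0 i) := by
  rw [qBracket_mul_qBracket hq hp (hxy 0) (hxx 0 i h0i) (hyy 0 i h0i) (hxy' 0 i h0i)
      (hyx 0 i h0i),
    qBracket_mul_qBracket hq hp (hxy 0) (hxx 0 j (h0i.trans hij)) (hyy 0 j (h0i.trans hij))
      (hxy' 0 j (h0i.trans hij)) (hyx 0 j (h0i.trans hij)),
    hxx i j hij, hyy i j hij, hxy' i j hij, hyx i j hij]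
  simp only [mul_add, mul_smul_comm]
  match_scalars <;> field_simp <;> ring

end
end
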